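/- For every α ∈ (0,2], c > 0, a > 0, t > 0 and L > 0, the number variance admits the representation L/a + (2/π) ∫₀^∞ θ^{-2} e^{-2ct(θ/a)^α} (cos(Lθ/a) − 1) dθ = (2L/a) ∫_{L/a}^∞ g(z) dz + 2 ∫₀^{L/a} z g(z) dz, where g(z) := (1/π) ∫₀^∞ cos(zθ) e^{-(2ct/a^α) θ^α} dθ is the symmetric α-stable transition density at time 2t/a^α. -/

import Mathlib

open MeasureTheory Filter Set

/-- Symmetric `α`-stable transition density at time `s`, defined by Fourier inversion. -/
noncomputable def stablePDF (α c s z : ℝ) : ℝ :=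
  (1 / Real.pi) * ∫ θ in Set.Ioi (0:ℝ), Real.cos (z * θ) * Real.exp (-(c * s * θ ^ α))

open scoped Topology FourierTransform

/-- An even function that is integrable on the positive half-line is integrable. -/
lemma integrable_of_integrableOn_Ioi_of_even {E : Type*} [NormedAddCommGroup E] {f : ℝ → E}
    (hf : IntegrableOn f (Ioi 0)) (heven : ∀ x, f (-x) = f x) : Integrable f := by
  have h : IntegrableOn f (Iio 0) := by
    have := IntegrableOn.comp_neg_Iio (c := 0) (f := f) (by simpa using hf)
    simpa only [heven] using this
  rw [← integrableOn_univ, ← Iic_union_Ioi (a := (0 : ℝ))]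
  exact ((integrableOn_Iic_iff_integrableOn_Iio (by finiteness)).2 h).union hf

/-- The Fourier cosine transform of `φ`. -/
noncomputable def cosTransform (φ : ℝ → ℝ) (z : ℝ) : ℝ :=
  ∫ θ in Ioi (0 : ℝ), Real.cos (z * θ) * φ θ

lemma integrableOn_cos_mul {φ : ℝ → ℝ} {s : Set ℝ} (hφ : IntegrableOn φ s) (z : ℝ) :
    IntegrableOn (fun θ ↦ Real.cos (z * θ) * φ θ) s :=
  Integrable.bdd_mul (c := 1) hφ (by fun_prop) (ae_of_all _ fun θ ↦ Real.abs_cos_le_one _)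

lemma integrableOn_sin_mul {φ : ℝ → ℝ} {s : Set ℝ} (hφ : IntegrableOn φ s) (z : ℝ) :
    IntegrableOn (fun θ ↦ Real.sin (z * θ) * φ θ) s :=
  Integrable.bdd_mul (c := 1) hφ (by fun_prop) (ae_of_all _ fun θ ↦ Real.abs_sin_le_one _)

lemma continuous_cosTransform {φ : ℝ → ℝ} (hφ : IntegrableOn φ (Ioi 0)) :
    Continuous (cosTransform φ) := by
  refine continuous_of_dominated (bound := fun θ ↦ ‖φ θ‖)
    (fun z ↦ (integrableOn_cos_mul hφ z).aestronglyMeasurable) (fun z ↦ ae_of_all _ fun θ ↦ ?_)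
    hφ.norm (ae_of_all _ fun θ ↦ by fun_prop)
  rw [norm_mul]
  exact mul_le_of_le_one_left (norm_nonneg _) (Real.abs_cos_le_one _)

lemma cosTransform_neg (φ : ℝ → ℝ) (z : ℝ) : cosTransform φ (-z) = cosTransform φ z := by
  simp [cosTransform, neg_mul]

/-- A function with a mild singularity at the origin, controlled together with its derivative by
powers, has a sine transform of polynomial decay. -/
lemma abs_integral_sin_mul_le {ψ ψ' : ℝ → ℝ} {C β : ℝ} (hβ : β ∈ Ioo (0 : ℝ) 1)
    (hψ : ∀ x, 0 < x → HasDerivAt ψ (ψ' x) x) (hψ' : ContinuousOn ψ' (Ioi 0))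
    (hψi : IntegrableOn ψ (Ioi 0))
    (h1 : ∀ x, 0 < x → |ψ x| ≤ C * x ^ (β - 1)) (h2 : ∀ x, 0 < x → |ψ' x| ≤ C * x ^ (β - 2))
    {z : ℝ} (hz : 0 < z) :
    |∫ θ in Ioi (0 : ℝ), Real.sin (z * θ) * ψ θ| ≤ C * (1 / β + 1 + 1 / (1 - β)) * z ^ (-β) := by
  obtain ⟨hβ0, hβ1⟩ := hβ
  have hδ : 0 < z⁻¹ := inv_pos.2 hz
  have hpow : z⁻¹ ^ β = z ^ (-β) := by rw [Real.rpow_neg hz.le, Real.inv_rpow hz.le]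
  have hpow' : z⁻¹ ^ (β - 1) = z ^ (-β) * z := by
    rw [Real.rpow_sub_one hδ.ne', hpow, div_inv_eq_mul]
  have hnear : |∫ θ in Ioc 0 z⁻¹, Real.sin (z * θ) * ψ θ| ≤ C * (1 / β) * z ^ (-β) := by
    have hi : IntervalIntegrable (fun x : ℝ ↦ C * x ^ (β - 1)) volume 0 z⁻¹ :=
      (intervalIntegral.intervalIntegrable_rpow' (by linarith)).const_mul C
    have hval : ∫ θ in Ioc 0 z⁻¹, C * θ ^ (β - 1) = C * (1 / β) * z ^ (-β) := by
      rw [← intervalIntegral.integral_of_le hδ.le, intervalIntegral.integral_const_mul,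
        integral_rpow (Or.inl (by linarith)), sub_add_cancel, Real.zero_rpow hβ0.ne', hpow]
      ring
    rw [← hval, ← Real.norm_eq_abs]
    refine norm_integral_le_of_norm_le ((intervalIntegrable_iff_integrableOn_Ioc_of_le hδ.le).1 hi)
      ((ae_restrict_iff' measurableSet_Ioc).2 (ae_of_all _ fun θ hθ ↦ ?_))
    rw [norm_mul]
    exact (mul_le_of_le_one_left (norm_nonneg _) (Real.abs_sin_le_one _)).trans (h1 θ hθ.1)
  have hmaj : IntegrableOn (fun x : ℝ ↦ C * x ^ (β - 2)) (Ioi z⁻¹) :=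
    (integrableOn_Ioi_rpow_of_lt (by linarith) hδ).const_mul C
  have hψ'i : IntegrableOn ψ' (Ioi z⁻¹) :=
    Integrable.mono' hmaj ((hψ'.mono (Ioi_subset_Ioi hδ.le)).aestronglyMeasurable
      measurableSet_Ioi) ((ae_restrict_iff' measurableSet_Ioi).2
        (ae_of_all _ fun θ hθ ↦ h2 θ (hδ.trans hθ)))
  have hfar : |∫ θ in Ioi z⁻¹, Real.sin (z * θ) * ψ θ|
      ≤ C * (1 + 1 / (1 - β)) * z ^ (-β) := by
    have hv : ∀ x ∈ Ioi z⁻¹, HasDerivAt (fun θ ↦ -(Real.cos (z * θ) / z)) (Real.sin (z * x)) x := by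
      intro x _
      have := (((hasDerivAt_id x).const_mul z).cos.div_const z).neg
      convert! this using 1
      field_simp
      simp
    have hparts := integral_Ioi_mul_deriv_eq_deriv_mul (a := z⁻¹) (u := ψ) (u' := ψ')
      (v := fun θ ↦ -(Real.cos (z * θ) / z)) (v' := fun θ ↦ Real.sin (z * θ))
      (a' := ψ z⁻¹ * -(Real.cos (z * z⁻¹) / z)) (b' := 0)
      (fun x hx ↦ hψ x (hδ.trans hx)) hv ?_ ?_ ?_ ?_
    · have hswap : ∫ θ in Ioi z⁻¹, Real.sin (z * θ) * ψ θ
          = ∫ θ in Ioi z⁻¹, ψ θ * Real.sin (z * θ) := by simp_rw [mul_comm]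
      have hval : ∫ θ in Ioi z⁻¹, C * θ ^ (β - 2) = C * (1 / (1 - β)) * z ^ (-β) * z := by
        rw [integral_const_mul, integral_Ioi_rpow_of_lt (by linarith) hδ,
          show β - 2 + 1 = β - 1 by ring, hpow', show β - 1 = -(1 - β) by ring, neg_div_neg_eq]
        ring
      have hb : |∫ θ in Ioi z⁻¹, ψ' θ * -(Real.cos (z * θ) / z)|
          ≤ C * (1 / (1 - β)) * z ^ (-β) := by
        have heq : ∫ θ in Ioi z⁻¹, ψ' θ * -(Real.cos (z * θ) / z)
            = -(∫ θ in Ioi z⁻¹, Real.cos (z * θ) * ψ' θ) / z := by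
          rw [← integral_neg, ← integral_div]
          congr 1 with θ
          ring
        rw [heq, abs_div, abs_neg, abs_of_pos hz, div_le_iff₀ hz, ← hval,
          ← Real.norm_eq_abs]
        refine norm_integral_le_of_norm_le hmaj
          ((ae_restrict_iff' measurableSet_Ioi).2 (ae_of_all _ fun θ hθ ↦ ?_))
        rw [norm_mul]
        exact (mul_le_of_le_one_left (norm_nonneg _) (Real.abs_cos_le_one _)).trans
          (h2 θ (hδ.trans hθ))
      have hb0 : |ψ z⁻¹ * -(Real.cos (z * z⁻¹) / z)| ≤ C * z ^ (-β) := by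
        have := h1 _ hδ
        rw [hpow'] at this
        rw [mul_neg, abs_neg, abs_mul, abs_div, abs_of_pos hz, mul_div_assoc', div_le_iff₀ hz,
          mul_assoc]
        exact (mul_le_of_le_one_right (abs_nonneg _) (Real.abs_cos_le_one _)).trans this
      rw [hswap, hparts, zero_sub]
      calc _ ≤ _ := abs_sub _ _
        _ ≤ C * z ^ (-β) + C * (1 / (1 - β)) * z ^ (-β) := by rw [abs_neg]; gcongr
        _ = _ := by ring
    · exact (integrableOn_sin_mul (hψi.mono_set (Ioi_subset_Ioi hδ.le)) z).congr
        (ae_of_all _ fun θ ↦ mul_comm _ _)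
    · refine ((integrableOn_cos_mul hψ'i z).div_const (-z)).congr (ae_of_all _ fun θ ↦ ?_)
      simp only [Pi.mul_apply]
      ring
    · have hc : ContinuousAt (ψ * fun θ ↦ -(Real.cos (z * θ) / z)) z⁻¹ :=
        (hψ _ hδ).continuousAt.mul (by fun_prop)
      exact hc.tendsto.mono_left nhdsWithin_le_nhds
    · have hlim : Tendsto (fun x : ℝ ↦ C * x ^ (-(1 - β)) * z⁻¹) atTop (𝓝 0) := by
        simpa using ((tendsto_rpow_neg_atTop (sub_pos.2 hβ1)).const_mul C).mul_const z⁻¹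
      refine squeeze_zero_norm' ?_ hlim
      filter_upwards [eventually_gt_atTop 0] with x hx
      rw [Pi.mul_apply, norm_mul, norm_neg, norm_div, div_eq_mul_inv, ← mul_assoc,
        Real.norm_of_nonneg hz.le, neg_sub]
      exact mul_le_mul_of_nonneg_right ((mul_le_of_le_one_right (abs_nonneg _)
        (Real.abs_cos_le_one _)).trans (h1 x hx)) (inv_nonneg.2 hz.le)
  rw [← Ioc_union_Ioi_eq_Ioi hδ.le, setIntegral_union (Ioc_disjoint_Ioi le_rfl) measurableSet_Ioi
    ((integrableOn_sin_mul hψi z).mono_set Ioc_subset_Ioi_self)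
    ((integrableOn_sin_mul hψi z).mono_set (Ioi_subset_Ioi hδ.le))]
  calc _ ≤ _ := abs_add_le _ _
    _ ≤ _ := add_le_add hnear hfar
    _ = _ := by ring

/-- Integration by parts in the cosine transform. -/
lemma cosTransform_eq_neg_integral_sin_mul {φ φ' : ℝ → ℝ} {c : ℝ}
    (hφ : ∀ x, 0 < x → HasDerivAt φ (φ' x) x)
    (hφi : IntegrableOn φ (Ioi 0)) (hφ'i : IntegrableOn φ' (Ioi 0))
    (h0 : Tendsto φ (𝓝[>] 0) (𝓝 c)) (hinf : Tendsto φ atTop (𝓝 0)) {z : ℝ} (hz : 0 < z) :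
    cosTransform φ z = -(∫ θ in Ioi (0 : ℝ), Real.sin (z * θ) * φ' θ) / z := by
  have hv : ∀ x ∈ Ioi (0 : ℝ),
      HasDerivAt (fun θ ↦ Real.sin (z * θ) / z) (Real.cos (z * x)) x := by
    intro x _
    have := ((hasDerivAt_id x).const_mul z).sin.div_const z
    convert! this using 1
    field_simp
    simp
  have hparts := integral_Ioi_mul_deriv_eq_deriv_mul (a := 0) (u := φ) (u' := φ')
    (v := fun θ ↦ Real.sin (z * θ) / z) (v' := fun θ ↦ Real.cos (z * θ))
    (a' := 0) (b' := 0) hφ hv ?_ ?_ ?_ ?_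
  · rw [cosTransform, ← integral_neg, ← integral_div]
    simp_rw [mul_comm (Real.cos _)]
    rw [hparts, sub_zero, zero_sub, ← integral_neg]
    congr 1 with θ
    ring
  · exact (integrableOn_cos_mul hφi z).congr (ae_of_all _ fun θ ↦ mul_comm _ _)
  · refine ((integrableOn_sin_mul hφ'i z).div_const z).congr (ae_of_all _ fun θ ↦ ?_)
    simp only [Pi.mul_apply]
    ring
  · have hs : Tendsto (fun θ ↦ Real.sin (z * θ) / z) (𝓝[>] 0) (𝓝 0) := by
      have : Continuous fun θ ↦ Real.sin (z * θ) / z := by fun_prop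
      simpa using (this.tendsto 0).mono_left (nhdsWithin_le_nhds (s := Ioi 0))
    have := h0.mul hs
    rwa [mul_zero] at this
  · refine squeeze_zero_norm (a := fun x ↦ ‖φ x‖ / z) (fun x ↦ ?_)
      (by simpa using hinf.norm.div_const z)
    rw [Pi.mul_apply, norm_mul, norm_div, Real.norm_of_nonneg hz.le, mul_div_assoc']
    gcongr
    exact mul_le_of_le_one_right (norm_nonneg _) (Real.abs_sin_le_one _)

lemma integrableOn_cosTransform {φ φ' φ'' : ℝ → ℝ} {c C β : ℝ} (hβ : β ∈ Ioo (0 : ℝ) 1)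
    (hφ : ∀ x, 0 < x → HasDerivAt φ (φ' x) x) (hφ' : ∀ x, 0 < x → HasDerivAt φ' (φ'' x) x)
    (hφ'' : ContinuousOn φ'' (Ioi 0))
    (hφi : IntegrableOn φ (Ioi 0)) (hφ'i : IntegrableOn φ' (Ioi 0))
    (h0 : Tendsto φ (𝓝[>] 0) (𝓝 c)) (hinf : Tendsto φ atTop (𝓝 0))
    (h1 : ∀ x, 0 < x → |φ' x| ≤ C * x ^ (β - 1)) (h2 : ∀ x, 0 < x → |φ'' x| ≤ C * x ^ (β - 2)) :
    IntegrableOn (cosTransform φ) (Ioi 0) := by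
  have hcont := continuous_cosTransform hφi
  rw [← Ioc_union_Ioi_eq_Ioi (zero_le_one (α := ℝ))]
  refine (hcont.integrableOn_Ioc).union ?_
  refine Integrable.mono' (g := fun z ↦ C * (1 / β + 1 + 1 / (1 - β)) * z ^ (-β - 1))
    ((integrableOn_Ioi_rpow_of_lt (by linarith [hβ.1]) one_pos).const_mul _)
    hcont.aestronglyMeasurable
    ((ae_restrict_iff' measurableSet_Ioi).2 (ae_of_all _ fun z hz ↦ ?_))
  have hz : 0 < z := one_pos.trans hz
  rw [cosTransform_eq_neg_integral_sin_mul hφ hφi hφ'i h0 hinf hz, norm_div, norm_neg,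
    Real.norm_of_nonneg hz.le, Real.rpow_sub_one hz.ne', mul_div_assoc']
  gcongr
  exact abs_integral_sin_mul_le hβ hφ' hφ'' hφ'i h1 h2 hz

/-- Fourier inversion at the origin for the cosine transform. -/
lemma integral_cosTransform {φ : ℝ → ℝ} (hφ : Continuous φ) (hφi : IntegrableOn φ (Ioi 0))
    (hG : IntegrableOn (cosTransform φ) (Ioi 0)) :
    ∫ z in Ioi (0 : ℝ), cosTransform φ z = Real.pi / 2 * φ 0 := by
  set f : ℝ → ℂ := fun θ ↦ (φ |θ| : ℂ) with hf
  have heven : ∀ x, f (-x) = f x := fun x ↦ by simp [hf]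
  have hcont : Continuous f := by fun_prop
  have hfi : Integrable f := by
    refine integrable_of_integrableOn_Ioi_of_even ?_ heven
    have hφi' : IntegrableOn (fun x ↦ (φ x : ℂ)) (Ioi 0) := hφi.ofReal
    exact hφi'.congr_fun
      (fun x hx ↦ by simp [hf, abs_of_pos (show (0 : ℝ) < x from hx)]) measurableSet_Ioi
  have hF : 𝓕 f = fun w ↦ ((2 * cosTransform φ (2 * Real.pi * w) : ℝ) : ℂ) := by
    ext w
    set h : ℝ → ℂ := fun v ↦ Complex.exp (↑(-2 * Real.pi * v * w) * Complex.I) • f v with hh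
    have hhi : Integrable h := by
      refine Integrable.bdd_mul (c := 1) hfi (by fun_prop) (ae_of_all _ fun v ↦ ?_)
      rw [Complex.norm_exp_ofReal_mul_I]
    rw [Real.fourier_real_eq_integral_exp_smul, ← intervalIntegral.integral_Iic_add_Ioi
      (b := (0 : ℝ)) hhi.integrableOn hhi.integrableOn]
    have hneg : ∫ x in Iic (0 : ℝ), h x = ∫ x in Ioi (0 : ℝ), h (-x) := by
      rw [integral_comp_neg_Ioi, neg_zero]
    rw [hneg, ← integral_add hhi.comp_neg.integrableOn hhi.integrableOn, cosTransform,
      ← integral_const_mul, ← integral_complex_ofReal]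
    refine setIntegral_congr_fun measurableSet_Ioi fun x hx ↦ ?_
    simp only [hh, heven, smul_eq_mul, ← add_mul]
    simp only [hf, abs_of_pos (show (0 : ℝ) < x from hx)]
    push_cast
    rw [← mul_assoc, Complex.two_cos]
    congr 1
    ring_nf
  have hGi : Integrable (cosTransform φ) :=
    integrable_of_integrableOn_Ioi_of_even hG (cosTransform_neg φ)
  have hGr : Integrable fun w ↦ 2 * cosTransform φ (2 * Real.pi * w) :=
    (hGi.comp_mul_left' (by positivity)).const_mul 2
  have hinv := hfi.fourierInv_fourier_eq (by rw [hF]; exact hGr.ofReal) (hcont.continuousAt (x := 0))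
  rw [Real.fourierInv_eq', hF] at hinv
  simp only [inner_zero_right, mul_zero, Complex.ofReal_zero, zero_mul, Complex.exp_zero,
    one_smul, hf, abs_zero] at hinv
  rw [integral_complex_ofReal, Complex.ofReal_inj, integral_const_mul,
    Measure.integral_comp_mul_left (cosTransform φ)] at hinv
  have habs : ∫ z, cosTransform φ z = 2 * ∫ z in Ioi (0 : ℝ), cosTransform φ z := by
    rw [← integral_comp_abs]
    congr 1 with z
    rcases abs_choice z with h | h <;> rw [h]
    rw [cosTransform_neg]
  rw [habs, abs_of_pos (by positivity), smul_eq_mul] at hinv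
  rw [← hinv]
  field_simp

lemma integral_sub_mul_cos (M : ℝ) {θ : ℝ} (hθ : θ ≠ 0) :
    ∫ z in (0 : ℝ)..M, (M - z) * Real.cos (z * θ) = (1 - Real.cos (M * θ)) / θ ^ 2 := by
  have hd : ∀ z ∈ uIcc 0 M, HasDerivAt
      (fun z ↦ (M - z) * Real.sin (z * θ) / θ - Real.cos (z * θ) / θ ^ 2)
      ((M - z) * Real.cos (z * θ)) z := by
    intro z _
    have h0 := (hasDerivAt_id z).mul_const θ
    have := ((((hasDerivAt_id z).const_sub M).mul h0.sin).div_const θ).sub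
      (h0.cos.div_const (θ ^ 2))
    convert! this using 1
    simp only [id]
    field_simp
    ring
  rw [intervalIntegral.integral_eq_sub_of_hasDerivAt hd
    (Continuous.intervalIntegrable (by fun_prop) _ _)]
  simp
  ring

/-- Integrating the cosine transform against a triangular weight. -/
lemma integral_sub_mul_cosTransform {φ : ℝ → ℝ} (hφi : IntegrableOn φ (Ioi 0)) (M : ℝ) :
    ∫ z in (0 : ℝ)..M, (M - z) * cosTransform φ z
      = ∫ θ in Ioi (0 : ℝ), φ θ * (1 - Real.cos (M * θ)) / θ ^ 2 := by
  simp_rw [cosTransform, ← integral_const_mul]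
  rw [intervalIntegral_integral_swap]
  · refine setIntegral_congr_fun measurableSet_Ioi fun θ hθ ↦ ?_
    simp only [← mul_assoc]
    rw [intervalIntegral.integral_mul_const, integral_sub_mul_cos M (ne_of_gt hθ)]
    ring
  · have h1 : Integrable (fun z : ℝ ↦ M - z) (volume.restrict (uIoc 0 M)) :=
      intervalIntegrable_iff.1 (Continuous.intervalIntegrable (by fun_prop) _ _)
    refine (Integrable.bdd_mul (c := 1) (f := fun p : ℝ × ℝ ↦ Real.cos (p.1 * p.2))
      (h1.mul_prod hφi) (by fun_prop)
      (ae_of_all _ fun p ↦ Real.abs_cos_le_one _)).congr (ae_of_all _ fun p ↦ ?_)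
    simp only [Function.uncurry]
    ring

lemma integrableOn_rpow_mul_exp_neg_mul_rpow_Ioi {k α q : ℝ} (hk : 0 < k) (hα : 0 < α)
    (hq : -1 < q) : IntegrableOn (fun x : ℝ ↦ x ^ q * Real.exp (-(k * x ^ α))) (Ioi 0) := by
  by_contra h
  have h0 := integral_undef h
  simp_rw [← neg_mul] at h0
  rw [integral_rpow_mul_exp_neg_mul_rpow hα hq hk] at h0
  have : 0 < Real.Gamma ((q + 1) / α) := Real.Gamma_pos_of_pos (div_pos (by linarith) hα)
  exact absurd h0 (by positivity)

lemma exists_rpow_mul_exp_neg_mul_rpow_le {k α r : ℝ} (hk : 0 < k) (hα : 0 < α) (hr : 0 < r) :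
    ∃ C, 0 ≤ C ∧ ∀ x : ℝ, 0 < x → x ^ r * Real.exp (-(k * x ^ α)) ≤ C := by
  have hq : 0 < r / α := div_pos hr hα
  refine ⟨(r / α / k) ^ (r / α), by positivity, fun x hx ↦ ?_⟩
  have hy : 0 < x ^ α := Real.rpow_pos_of_pos hx α
  have h1 : x ^ α ≤ r / α / k * Real.exp (k * x ^ α / (r / α)) := by
    have := Real.add_one_le_exp (k * x ^ α / (r / α))
    calc x ^ α = r / α / k * (k * x ^ α / (r / α)) := by field_simp
      _ ≤ _ := by gcongr; linarith
  have h2 := Real.rpow_le_rpow hy.le h1 hq.le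
  rw [← Real.rpow_mul hx.le, mul_div_cancel₀ _ hα.ne', Real.mul_rpow (by positivity)
    (Real.exp_pos _).le, ← Real.exp_mul, div_mul_cancel₀ _ hq.ne'] at h2
  calc _ ≤ (r / α / k) ^ (r / α) * Real.exp (k * x ^ α) * Real.exp (-(k * x ^ α)) := by gcongr
    _ = _ := by rw [mul_assoc, ← Real.exp_add, add_neg_cancel, Real.exp_zero, mul_one]

/-- The cosine transform of a stretched exponential of any positive index is integrable. -/
lemma integrableOn_cosTransform_exp_neg_mul_rpow {k α : ℝ} (hk : 0 < k) (hα : 0 < α) :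
    IntegrableOn (cosTransform fun θ ↦ Real.exp (-(k * θ ^ α))) (Ioi 0) := by
  obtain ⟨β, hβ0, hβ1, hβα⟩ : ∃ β : ℝ, 0 < β ∧ β < 1 ∧ β < α := by
    obtain ⟨β, h0, h1⟩ := exists_between (lt_min one_pos hα)
    exact ⟨β, h0, lt_min_iff.1 h1⟩
  obtain ⟨A, hA0, hA⟩ := exists_rpow_mul_exp_neg_mul_rpow_le hk hα (sub_pos.2 hβα)
  obtain ⟨B, hB0, hB⟩ := exists_rpow_mul_exp_neg_mul_rpow_le hk hα
    (r := 2 * α - β) (by linarith)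
  have hpow (p : ℝ) {x : ℝ} (hx : 0 < x) : HasDerivAt (fun x : ℝ ↦ x ^ p) (p * x ^ (p - 1)) x :=
    Real.hasDerivAt_rpow_const (Or.inl hx.ne')
  have hexp {x : ℝ} (hx : 0 < x) : HasDerivAt (fun θ : ℝ ↦ Real.exp (-(k * θ ^ α)))
      (-(k * α) * (x ^ (α - 1) * Real.exp (-(k * x ^ α)))) x := by
    convert! ((hpow α hx).const_mul k).neg.exp using 1
    rw [Pi.neg_apply]
    ring
  have hexpc : Continuous fun θ : ℝ ↦ Real.exp (-(k * θ ^ α)) := by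
    have := Real.continuous_rpow_const hα.le
    fun_prop
  refine integrableOn_cosTransform (c := 1) (β := β)
    (C := k * α * A + k * α * (|α - 1| * A + k * α * B))
    (φ' := fun x ↦ -(k * α) * (x ^ (α - 1) * Real.exp (-(k * x ^ α))))
    (φ'' := fun x ↦ -(k * α) * (((α - 1) * x ^ (α - 2) - k * α * x ^ (2 * α - 2)) *
      Real.exp (-(k * x ^ α)))) ⟨hβ0, hβ1⟩ (fun x hx ↦ hexp hx) (fun x hx ↦ ?_) ?_ ?_ ?_ ?_ ?_
    (fun x hx ↦ ?_) (fun x hx ↦ ?_)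
  · convert! ((hpow (α - 1) hx).mul (hexp hx)).const_mul (-(k * α)) using 1
    have : x ^ (2 * α - 2) = x ^ (α - 1) * x ^ (α - 1) := by
      rw [← Real.rpow_add hx]; ring_nf
    rw [this, show α - 1 - 1 = α - 2 by ring]
    ring
  · have (p : ℝ) : ContinuousOn (fun x : ℝ ↦ x ^ p) (Ioi 0) :=
      fun x hx ↦ (hpow p hx).continuousAt.continuousWithinAt
    have h1 := this (α - 2)
    have h2 := this (2 * α - 2)
    have h3 := hexpc.continuousOn (s := Ioi 0)
    fun_prop
  · simpa using integrableOn_rpow_mul_exp_neg_mul_rpow_Ioi hk hα neg_one_lt_zero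
  · exact (integrableOn_rpow_mul_exp_neg_mul_rpow_Ioi hk hα (by linarith)).const_mul _
  · simpa [Real.zero_rpow hα.ne'] using (hexpc.tendsto 0).mono_left (nhdsWithin_le_nhds (s := Ioi 0))
  · exact Real.tendsto_exp_neg_atTop_nhds_zero.comp
      ((tendsto_rpow_atTop hα).const_mul_atTop hk)
  · have hx' : x ^ (α - 1) = x ^ (β - 1) * x ^ (α - β) := by rw [← Real.rpow_add hx]; ring_nf
    have hp : 0 < x ^ (β - 1) := Real.rpow_pos_of_pos hx _
    have hp' : 0 < x ^ (α - β) := Real.rpow_pos_of_pos hx _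
    rw [neg_mul, abs_neg, hx', abs_of_pos (by positivity)]
    calc _ = k * α * (x ^ (α - β) * Real.exp (-(k * x ^ α))) * x ^ (β - 1) := by ring
      _ ≤ k * α * A * x ^ (β - 1) := by gcongr; exact hA x hx
      _ ≤ _ := by gcongr; exact le_add_of_nonneg_right (by positivity)
  · have hx' : x ^ (α - 2) = x ^ (β - 2) * x ^ (α - β) := by rw [← Real.rpow_add hx]; ring_nf
    have hx'' : x ^ (2 * α - 2) = x ^ (β - 2) * x ^ (2 * α - β) := by
      rw [← Real.rpow_add hx]; ring_nf
    have hp : 0 < x ^ (β - 2) := Real.rpow_pos_of_pos hx _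
    have hp' : 0 < x ^ (α - β) := Real.rpow_pos_of_pos hx _
    have hp'' : 0 < x ^ (2 * α - β) := Real.rpow_pos_of_pos hx _
    rw [abs_mul, abs_neg, abs_of_pos (by positivity : 0 < k * α), abs_mul,
      abs_of_pos (Real.exp_pos _), hx', hx'']
    calc _ ≤ k * α * ((|(α - 1) * (x ^ (β - 2) * x ^ (α - β))| +
            |k * α * (x ^ (β - 2) * x ^ (2 * α - β))|) * Real.exp (-(k * x ^ α))) := by
          gcongr; exact abs_sub _ _
      _ = k * α * (|α - 1| * (x ^ (α - β) * Real.exp (-(k * x ^ α))) +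
            k * α * (x ^ (2 * α - β) * Real.exp (-(k * x ^ α)))) * x ^ (β - 2) := by
          rw [abs_mul, abs_of_pos (by positivity : 0 < x ^ (β - 2) * x ^ (α - β)),
            abs_of_pos (by positivity : 0 < k * α * (x ^ (β - 2) * x ^ (2 * α - β)))]
          ring
      _ ≤ k * α * (|α - 1| * A + k * α * B) * x ^ (β - 2) := by
          gcongr
          · exact hA x hx
          · exact hB x hx
      _ ≤ _ := by gcongr; exact le_add_of_nonneg_left (by positivity)

theorem numVar_tail_representation (α c a t L : ℝ) (hα : α ∈ Set.Ioc (0:ℝ) 2)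
    (hc : 0 < c) (ha : 0 < a) (ht : 0 < t) (hL : 0 < L) :
    L / a + (2 / Real.pi) * (∫ θ in Set.Ioi (0:ℝ),
        Real.exp (-(2 * c * t * (θ / a) ^ α)) * (Real.cos (L * θ / a) - 1) / θ ^ 2) =
      (2 * L / a) * (∫ z in Set.Ioi (L / a), stablePDF α c (2 * t / a ^ α) z) +
        2 * ∫ z in (0:ℝ)..(L / a), z * stablePDF α c (2 * t / a ^ α) z := by
  have hα0 : 0 < α := hα.1
  have haα : 0 < a ^ α := Real.rpow_pos_of_pos ha α
  have hM : 0 < L / a := div_pos hL ha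
  set k := c * (2 * t / a ^ α) with hkdef
  have hk : 0 < k := by positivity
  set φ : ℝ → ℝ := fun θ ↦ Real.exp (-(k * θ ^ α)) with hφ
  have hφc : Continuous φ := by
    have := Real.continuous_rpow_const hα0.le
    fun_prop
  have hφi : IntegrableOn φ (Ioi 0) := by
    simpa using integrableOn_rpow_mul_exp_neg_mul_rpow_Ioi hk hα0 neg_one_lt_zero
  have hG : IntegrableOn (cosTransform φ) (Ioi 0) :=
    integrableOn_cosTransform_exp_neg_mul_rpow hk hα0
  have hGc := continuous_cosTransform hφi
  have hpdf (z : ℝ) : stablePDF α c (2 * t / a ^ α) z = 1 / Real.pi * cosTransform φ z := rfl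
  have hlhs : ∫ θ in Ioi (0:ℝ),
        Real.exp (-(2 * c * t * (θ / a) ^ α)) * (Real.cos (L * θ / a) - 1) / θ ^ 2
      = -∫ z in (0 : ℝ)..L / a, (L / a - z) * cosTransform φ z := by
    rw [integral_sub_mul_cosTransform hφi, ← integral_neg]
    refine setIntegral_congr_fun measurableSet_Ioi fun θ hθ ↦ ?_
    have h1 : 2 * c * t * (θ / a) ^ α = k * θ ^ α := by
      rw [Real.div_rpow (le_of_lt hθ) ha.le, hkdef]
      ring
    simp only [hφ, h1, mul_div_right_comm L θ a]
    ring
  have htotal : (∫ z in (0 : ℝ)..L / a, cosTransform φ z) + ∫ z in Ioi (L / a), cosTransform φ z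
      = Real.pi / 2 := by
    rw [intervalIntegral.integral_interval_add_Ioi hG (hG.mono_set (Ioi_subset_Ioi hM.le)),
      integral_cosTransform hφc hφi hG]
    simp [hφ, Real.zero_rpow hα0.ne']
  have hsplit : ∫ z in (0 : ℝ)..L / a, (L / a - z) * cosTransform φ z
      = L / a * (∫ z in (0 : ℝ)..L / a, cosTransform φ z)
        - ∫ z in (0 : ℝ)..L / a, z * cosTransform φ z := by
    simp_rw [sub_mul]
    rw [intervalIntegral.integral_sub (Continuous.intervalIntegrable (by fun_prop) _ _)
      (Continuous.intervalIntegrable (by fun_prop) _ _), intervalIntegral.integral_const_mul]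
  simp_rw [hpdf, mul_left_comm _ (1 / Real.pi)]
  rw [hlhs, hsplit, integral_const_mul, intervalIntegral.integral_const_mul,
    eq_sub_of_add_eq' htotal]
  field_simp
  ring
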